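/- For the fractional Gaussian noise with Hurst index H ∈ (0,1), the limit L(H) := lim_{n→∞} (1/n) log det Σ_n(H) exists in ℝ and satisfies L(H) ≥ log σ²_H, where σ²_H = Γ(3/2 − H)/(Γ(H + 1/2) Γ(2 − 2H)); equivalently, the entropy rate H_∞(G^H) = lim_{n→∞} H(G^H_1,…,G^H_n)/n exists, is finite, and satisfies H_∞(G^H) ≥ (1 + log(2π))/2 + log σ_H. -/

import Mathlib

open Real Matrix Filter Topology

/-- Autocovariance of fractional Gaussian noise with Hurst index `H`. -/
noncomputable def fgnRho (H : ℝ) (k : ℕ) : ℝ :=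
  if k = 0 then 1
  else (((k : ℝ) + 1) ^ (2 * H) - 2 * (k : ℝ) ^ (2 * H) + ((k : ℝ) - 1) ^ (2 * H)) / 2

/-- Covariance matrix of `n` consecutive values of fractional Gaussian noise. -/
noncomputable def fgnCov (H : ℝ) (n : ℕ) : Matrix (Fin n) (Fin n) ℝ :=
  Matrix.of fun i j => fgnRho H (Nat.dist i.val j.val)

/-- The lower bound `σ²_H = Γ(3/2 − H) / (Γ(H + 1/2) Γ(2 − 2H))`. -/
noncomputable def fgnSigmaSq (H : ℝ) : ℝ :=
  Real.Gamma (3 / 2 - H) / (Real.Gamma (H + 1 / 2) * Real.Gamma (2 - 2 * H))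

open MeasureTheory Set

theorem betaIntegrand_integrableOn_and_integral_eq {p q : ℝ} (hp : 0 < p) (hq : 0 < q) :
    IntegrableOn (fun x : ℝ => x ^ (p - 1) * (1 - x) ^ (q - 1)) (Ioo 0 1) ∧
      ∫ x in Ioo (0 : ℝ) 1, x ^ (p - 1) * (1 - x) ^ (q - 1) = ProbabilityTheory.beta p q := by
  have hc := Complex.betaIntegral_convergent (u := p) (v := q) (by simpa) (by simpa)
  rw [intervalIntegrable_iff_integrableOn_Ioo_of_le zero_le_one] at hc
  have heq : EqOn (fun x : ℝ => (x : ℂ) ^ ((p : ℂ) - 1) * (1 - (x : ℂ)) ^ ((q : ℂ) - 1))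
      (fun x : ℝ => ((x ^ (p - 1) * (1 - x) ^ (q - 1) : ℝ) : ℂ)) (Ioo 0 1) := by
    intro x hx
    have h1 : (0 : ℝ) ≤ 1 - x := by linarith [hx.2]
    simp only [Complex.ofReal_mul]
    rw [Complex.ofReal_cpow hx.1.le, Complex.ofReal_cpow h1]
    push_cast
    rfl
  refine ⟨?_, ?_⟩
  · have := (hc.congr_fun heq measurableSet_Ioo).re
    simpa [IntegrableOn] using this
  · rw [ProbabilityTheory.beta_eq_betaIntegralReal p q hp hq, Complex.betaIntegral,
      intervalIntegral.integral_of_le zero_le_one, integral_Ioc_eq_integral_Ioo,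
      setIntegral_congr_fun measurableSet_Ioo heq, integral_complex_ofReal]
    simp

theorem image_div_one_sub_Ioo : (fun x : ℝ => x / (1 - x)) '' Ioo 0 1 = Ioi 0 := by
  ext y
  constructor
  · rintro ⟨x, hx, rfl⟩
    exact div_pos hx.1 (by linarith [hx.2])
  · intro hy
    have hy : 0 < y := hy
    refine ⟨y / (1 + y), ⟨by positivity, by rw [div_lt_one (by positivity)]; linarith⟩, ?_⟩
    have : 1 - y / (1 + y) = 1 / (1 + y) := by field_simp; ring
    simp only [this]
    field_simp

/-- The beta integral of the second kind. -/
theorem betaPrime_integrableOn_and_integral_eq {p q : ℝ} (hp : 0 < p) (hq : 0 < q) :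
    IntegrableOn (fun s : ℝ => s ^ (p - 1) * (1 + s) ^ (-(p + q))) (Ioi 0) ∧
      ∫ s in Ioi (0 : ℝ), s ^ (p - 1) * (1 + s) ^ (-(p + q)) = ProbabilityTheory.beta p q := by
  have hderiv : ∀ x ∈ Ioo (0 : ℝ) 1,
      HasDerivWithinAt (fun x : ℝ => x / (1 - x)) (1 / (1 - x) ^ 2) (Ioo 0 1) x := by
    intro x hx
    have h1 : (1 - x) ≠ 0 := by linarith [hx.2]
    have := ((hasDerivAt_id x).div ((hasDerivAt_id x).const_sub 1) h1).hasDerivWithinAt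
      (s := Ioo 0 1)
    refine this.congr_deriv ?_
    simp only [id]
    congr 1
    ring
  have hinj : InjOn (fun x : ℝ => x / (1 - x)) (Ioo 0 1) := by
    intro x hx y hy hxy
    have h1 : (1 - x) ≠ 0 := by linarith [hx.2]
    have h2 : (1 - y) ≠ 0 := by linarith [hy.2]
    simp only at hxy
    rw [div_eq_div_iff h1 h2] at hxy
    linarith
  have heq : EqOn (fun x : ℝ => |1 / (1 - x) ^ 2| •
      ((x / (1 - x)) ^ (p - 1) * (1 + x / (1 - x)) ^ (-(p + q))))
      (fun x : ℝ => x ^ (p - 1) * (1 - x) ^ (q - 1)) (Ioo 0 1) := by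
    intro x hx
    have hx0 := hx.1
    have h1 : 0 < 1 - x := by linarith [hx.2]
    have h2 : 1 + x / (1 - x) = (1 - x)⁻¹ := by field_simp; ring
    simp only [smul_eq_mul]
    rw [h2, abs_of_pos (by positivity), Real.div_rpow hx0.le h1.le, Real.inv_rpow h1.le,
      Real.rpow_neg h1.le, inv_inv, Real.rpow_sub_one h1.ne', Real.rpow_sub_one h1.ne',
      Real.rpow_add h1]
    have := Real.rpow_pos_of_pos h1 p
    field_simp
  obtain ⟨hi, hv⟩ := betaIntegrand_integrableOn_and_integral_eq hp hq
  rw [← image_div_one_sub_Ioo]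
  refine ⟨?_, ?_⟩
  · rw [integrableOn_image_iff_integrableOn_abs_deriv_smul measurableSet_Ioo hderiv hinj]
    exact hi.congr_fun heq.symm measurableSet_Ioo
  · rw [integral_image_eq_integral_abs_deriv_smul measurableSet_Ioo hderiv hinj,
      setIntegral_congr_fun measurableSet_Ioo heq, hv]

/-- For exponents in `(-1/2, 1/2)`, the primitive appearing in the evaluation of
`∫ ((1 + s) ^ a - s ^ a) ^ 2` over the half-line. -/
noncomputable def powDiffPrimitive (a s : ℝ) : ℝ :=
  (1 + s) ^ (2 * a + 1) + s ^ (2 * a + 1) - 2 * (s ^ (a + 1) * (1 + s) ^ a)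
    - s ^ (a + 1) * (1 + s) ^ (a - 1)

theorem rpow_two_mul {x : ℝ} (hx : 0 < x) (a : ℝ) : x ^ (2 * a) = (x ^ a) ^ 2 := by
  rw [mul_comm, Real.rpow_mul hx.le]; norm_num

theorem hasDerivAt_powDiffPrimitive (a : ℝ) {s : ℝ} (hs : 0 < s) :
    HasDerivAt (powDiffPrimitive a)
      ((2 * a + 1) * ((1 + s) ^ a - s ^ a) ^ 2 - (1 - a) * (s ^ a * (1 + s) ^ (a - 2))) s := by
  have h1 : 0 < 1 + s := by linarith
  have hX (c : ℝ) : HasDerivAt (fun s : ℝ => s ^ c) (c * s ^ (c - 1)) s :=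
    Real.hasDerivAt_rpow_const (Or.inl hs.ne')
  have hY (c : ℝ) : HasDerivAt (fun s : ℝ => (1 + s) ^ c) (c * (1 + s) ^ (c - 1)) s := by
    simpa using ((hasDerivAt_id s).const_add 1).rpow_const (p := c) (Or.inl h1.ne')
  have := (((hY (2 * a + 1)).add (hX (2 * a + 1))).sub
    (((hX (a + 1)).mul (hY a)).const_mul 2)).sub ((hX (a + 1)).mul (hY (a - 1)))
  refine this.congr_deriv ?_
  have e1 : a - 1 - 1 = a - 2 := by ring
  have e2 : (1 + s) ^ (a - 2) = (1 + s) ^ a / (1 + s) ^ 2 := by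
    rw [Real.rpow_sub h1]; norm_num
  simp only [add_sub_cancel_right, e1, e2, rpow_two_mul h1, rpow_two_mul hs,
    Real.rpow_add_one hs.ne', Real.rpow_sub_one h1.ne']
  field_simp
  ring

theorem powDiffPrimitive_zero {a : ℝ} (h1 : -(1 / 2) < a) : powDiffPrimitive a 0 = 1 := by
  have e1 : 2 * a + 1 ≠ 0 := by linarith
  have e2 : a + 1 ≠ 0 := by linarith
  simp [powDiffPrimitive, Real.zero_rpow e1, Real.zero_rpow e2]

theorem continuousAt_powDiffPrimitive_zero {a : ℝ} (h1 : -(1 / 2) < a) :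
    ContinuousAt (powDiffPrimitive a) 0 := by
  have hX {c : ℝ} (hc : 0 ≤ c) : ContinuousAt (fun s : ℝ => s ^ c) 0 :=
    Real.continuousAt_rpow_const _ _ (Or.inr hc)
  have hY (c : ℝ) : ContinuousAt (fun s : ℝ => (1 + s) ^ c) 0 :=
    ContinuousAt.rpow_const (by fun_prop) (Or.inl (by norm_num))
  unfold powDiffPrimitive
  exact (((hY _).add (hX (by linarith))).sub (((hX (by linarith)).mul (hY _)).const_mul 2)).sub
    ((hX (by linarith)).mul (hY _))

theorem exists_one_add_rpow_sub_rpow_eq (c : ℝ) {s : ℝ} (hs : 0 < s) :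
    ∃ t ∈ Ioo s (1 + s), (1 + s) ^ c - s ^ c = c * t ^ (c - 1) := by
  obtain ⟨t, ht, h⟩ := exists_hasDerivAt_eq_slope (fun x : ℝ => x ^ c)
    (fun x => c * x ^ (c - 1)) (by linarith : s < 1 + s)
    (fun x hx => (Real.continuousAt_rpow_const _ _
      (Or.inl (by linarith [hx.1]))).continuousWithinAt)
    (fun x hx => Real.hasDerivAt_rpow_const (Or.inl (by linarith [hx.1])))
  refine ⟨t, ht, ?_⟩
  rw [h]
  simp

theorem tendsto_powDiffPrimitive_atTop {a : ℝ} (h1 : -(1 / 2) < a) (h2 : a < 1 / 2) :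
    Tendsto (powDiffPrimitive a) atTop (𝓝 0) := by
  have hlim : Tendsto (fun s : ℝ => s ^ (2 * a - 1)) atTop (𝓝 0) := by
    have := tendsto_rpow_neg_atTop (y := 1 - 2 * a) (by linarith)
    simpa using this
  have hbound : Tendsto (fun s : ℝ => (a ^ 2 + (a + 1)) * s ^ (2 * a - 1)) atTop (𝓝 0) := by
    simpa using hlim.const_mul (a ^ 2 + (a + 1))
  refine tendsto_of_tendsto_of_tendsto_of_le_of_le' tendsto_const_nhds hbound ?_ ?_
  all_goals
    filter_upwards [eventually_gt_atTop 0] with s hs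
    have hs1 : 0 < 1 + s := by linarith
    have key : powDiffPrimitive a s = s * ((1 + s) ^ a - s ^ a) ^ 2
        + (1 + s) ^ (a - 1) * ((1 + s) ^ (a + 1) - s ^ (a + 1)) := by
      simp only [powDiffPrimitive, rpow_two_mul hs1, rpow_two_mul hs, Real.rpow_add_one hs.ne',
        Real.rpow_add_one hs1.ne', Real.rpow_sub_one hs1.ne']
      field_simp
      ring
    obtain ⟨t, ht, hte⟩ := exists_one_add_rpow_sub_rpow_eq a hs
    obtain ⟨u, hu, hue⟩ := exists_one_add_rpow_sub_rpow_eq (a + 1) hs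
    have ht0 : 0 < t := hs.trans ht.1
    have hu0 : 0 < u := hs.trans hu.1
    have ha1 : 0 ≤ a + 1 := by linarith
    rw [key, hte, hue, add_sub_cancel_right]
  · positivity
  · have b1 : s * (a * t ^ (a - 1)) ^ 2 ≤ a ^ 2 * s ^ (2 * a - 1) := by
      have e : s ^ (2 * a - 1) = s * (s ^ (a - 1)) ^ 2 := by
        rw [← rpow_two_mul hs, mul_comm s, ← Real.rpow_add_one hs.ne']
        congr 1; ring
      have : t ^ (a - 1) ≤ s ^ (a - 1) :=
        Real.rpow_le_rpow_of_nonpos hs ht.1.le (by linarith)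
      rw [e, mul_pow]
      have h3 : (t ^ (a - 1)) ^ 2 ≤ (s ^ (a - 1)) ^ 2 := by gcongr
      nlinarith [mul_le_mul_of_nonneg_left h3 (mul_nonneg hs.le (sq_nonneg a))]
    have b2 : (1 + s) ^ (a - 1) * ((a + 1) * u ^ a) ≤ (a + 1) * s ^ (2 * a - 1) := by
      have h4 : (1 + s) ^ (a - 1) * u ^ a ≤ s ^ (2 * a - 1) := by
        have e (x : ℝ) (hx : 0 < x) : x ^ (2 * a - 1) = x ^ (a - 1) * x ^ a := by
          rw [← Real.rpow_add hx]; congr 1; ring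
        calc (1 + s) ^ (a - 1) * u ^ a ≤ u ^ (a - 1) * u ^ a := by
              gcongr ?_ * _
              exact Real.rpow_le_rpow_of_nonpos hu0 hu.2.le (by linarith)
          _ = u ^ (2 * a - 1) := (e u hu0).symm
          _ ≤ s ^ (2 * a - 1) := Real.rpow_le_rpow_of_nonpos hs hu.1.le (by linarith)
      nlinarith [mul_le_mul_of_nonneg_left h4 ha1]
    linarith

theorem powDiff_sq_integrableOn_and_integral_eq {a : ℝ} (h1 : -(1 / 2) < a) (h2 : a < 1 / 2) :
    IntegrableOn (fun s : ℝ => ((1 + s) ^ a - s ^ a) ^ 2) (Ioi 0) ∧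
      (2 * a + 1) * ∫ s in Ioi (0 : ℝ), ((1 + s) ^ a - s ^ a) ^ 2 =
        (1 - a) * ProbabilityTheory.beta (a + 1) (1 - 2 * a) - 1 := by
  obtain ⟨hi, hv⟩ := betaPrime_integrableOn_and_integral_eq (p := a + 1) (q := 1 - 2 * a)
    (by linarith) (by linarith)
  have e1 : -(a + 1 + (1 - 2 * a)) = a - 2 := by ring
  rw [add_sub_cancel_right, e1] at hi hv
  set h : ℝ → ℝ := fun s => s ^ a * (1 + s) ^ (a - 2) with hh
  set Ψ : ℝ → ℝ := fun s => powDiffPrimitive a s + (1 - a) * ∫ x in (0 : ℝ)..s, h x with hΨ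
  have hpos : 0 < 2 * a + 1 := by linarith
  have hderiv : ∀ s ∈ Ioi (0 : ℝ), HasDerivAt Ψ ((2 * a + 1) * ((1 + s) ^ a - s ^ a) ^ 2) s := by
    intro s hs
    have hs : 0 < s := hs
    have hcont : ContinuousOn h (Ioi 0) := by
      intro x hx
      have hx : 0 < x := hx
      refine ContinuousAt.continuousWithinAt ?_
      exact (Real.continuousAt_rpow_const _ _ (Or.inl hx.ne')).mul
        (ContinuousAt.rpow_const (by fun_prop) (Or.inl (by linarith)))
    have hI : HasDerivAt (fun s => ∫ x in (0 : ℝ)..s, h x) (h s) s := by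
      refine intervalIntegral.integral_hasDerivAt_right ?_ ?_ ?_
      · rw [intervalIntegrable_iff_integrableOn_Ioc_of_le hs.le]
        exact hi.mono_set Ioc_subset_Ioi_self
      · exact hcont.stronglyMeasurableAtFilter isOpen_Ioi s hs
      · exact hcont.continuousAt (Ioi_mem_nhds hs)
    refine ((hasDerivAt_powDiffPrimitive a hs).add (hI.const_mul (1 - a))).congr_deriv ?_
    simp only [hh]
    ring
  have hcont : ContinuousWithinAt Ψ (Ici 0) 0 := by
    refine (continuousAt_powDiffPrimitive_zero h1).continuousWithinAt.add
      (ContinuousWithinAt.const_mul ?_ _)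
    have : ContinuousOn (fun s => ∫ x in (0 : ℝ)..s, h x) (uIcc 0 1) :=
      intervalIntegral.continuousOn_primitive_interval (by
        rw [uIcc_of_le zero_le_one, integrableOn_Icc_iff_integrableOn_Ioc]
        exact hi.mono_set Ioc_subset_Ioi_self)
    rw [uIcc_of_le zero_le_one] at this
    exact (this 0 (by simp)).mono_of_mem_nhdsWithin (Icc_mem_nhdsGE zero_lt_one)
  have hlim : Tendsto Ψ atTop (𝓝 (0 + (1 - a) * ∫ x in Ioi (0 : ℝ), h x)) :=
    (tendsto_powDiffPrimitive_atTop h1 h2).add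
      ((intervalIntegral_tendsto_integral_Ioi 0 hi tendsto_id).const_mul (1 - a))
  have hnonneg : ∀ s ∈ Ioi (0 : ℝ), 0 ≤ (2 * a + 1) * ((1 + s) ^ a - s ^ a) ^ 2 :=
    fun s _ => by positivity
  have hInt := integrableOn_Ioi_deriv_of_nonneg hcont hderiv hnonneg hlim
  have hval := integral_Ioi_of_hasDerivAt_of_nonneg hcont hderiv hnonneg hlim
  refine ⟨?_, ?_⟩
  · have := hInt.const_mul (2 * a + 1)⁻¹
    simpa [← mul_assoc, inv_mul_cancel₀ hpos.ne', IntegrableOn] using this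
  · rw [← integral_const_mul, hval, hv]
    simp [hΨ, powDiffPrimitive_zero h1]

/-- The one-sided power function `x ↦ x₊ ^ a`, vanishing on `(-∞, 0]`. -/
noncomputable def posPow (a x : ℝ) : ℝ := if 0 < x then x ^ a else 0

/-- The squared `L²` norm of the unit increment of the Mandelbrot–Van Ness kernel. -/
noncomputable def posPowNormSq (a : ℝ) : ℝ := ∫ u : ℝ, (posPow a u - posPow a (u - 1)) ^ 2

theorem rpow_sq_integrableOn_Ioc {a : ℝ} (h1 : -(1 / 2) < a) :
    IntegrableOn (fun u : ℝ => (u ^ a) ^ 2) (Ioc 0 1) ∧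
      ∫ u in Ioc (0 : ℝ) 1, (u ^ a) ^ 2 = 1 / (2 * a + 1) := by
  have heq : EqOn (fun u : ℝ => u ^ (2 * a)) (fun u : ℝ => (u ^ a) ^ 2) (Ioc 0 1) :=
    fun u hu => rpow_two_mul hu.1 a
  have hpos : 2 * a + 1 ≠ 0 := by linarith
  refine ⟨?_, ?_⟩
  · have := intervalIntegral.intervalIntegrable_rpow' (a := 0) (b := 1) (r := 2 * a) (by linarith)
    rw [intervalIntegrable_iff_integrableOn_Ioc_of_le zero_le_one] at this
    exact this.congr_fun heq measurableSet_Ioc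
  · rw [← setIntegral_congr_fun measurableSet_Ioc heq,
      ← intervalIntegral.integral_of_le zero_le_one, integral_rpow (Or.inl (by linarith))]
    simp [Real.zero_rpow hpos]

theorem posPow_sub_sq_integrable_and_normSq_eq {a : ℝ} (h1 : -(1 / 2) < a) (h2 : a < 1 / 2) :
    Integrable (fun u : ℝ => (posPow a u - posPow a (u - 1)) ^ 2) ∧
      (2 * a + 1) * posPowNormSq a = (1 - a) * ProbabilityTheory.beta (a + 1) (1 - 2 * a) := by
  obtain ⟨hi1, hv1⟩ := rpow_sq_integrableOn_Ioc h1
  obtain ⟨hi2, hv2⟩ := powDiff_sq_integrableOn_and_integral_eq h1 h2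
  have hpos : 0 < 2 * a + 1 := by linarith
  set F : ℝ → ℝ := (Ioc (0 : ℝ) 1).indicator fun u => (u ^ a) ^ 2 with hF
  set G : ℝ → ℝ := (Ioi (0 : ℝ)).indicator fun s => ((1 + s) ^ a - s ^ a) ^ 2 with hG
  have heq : (fun u : ℝ => (posPow a u - posPow a (u - 1)) ^ 2) = fun u => F u + G (u - 1) := by
    funext u
    rcases le_or_gt u 0 with hu | hu
    · have : ¬ 1 < u := by linarith
      simp [posPow, hF, hG, hu.not_gt, this]
    · rcases le_or_gt u 1 with hu1 | hu1
      · simp [posPow, hF, hG, hu, hu1, hu1.not_gt]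
      · simp [posPow, hF, hG, hu, hu1, hu1.not_ge]
  have hFi : Integrable F := hi1.integrable_indicator measurableSet_Ioc
  have hGi : Integrable (fun u => G (u - 1)) :=
    (hi2.integrable_indicator measurableSet_Ioi).comp_sub_right 1
  unfold posPowNormSq
  rw [heq]
  refine ⟨hFi.add hGi, ?_⟩
  rw [integral_add hFi hGi, integral_sub_right_eq_self G, hF, hG,
    integral_indicator measurableSet_Ioc, integral_indicator measurableSet_Ioi, mul_add, hv1, hv2]
  field_simp
  ring

theorem posPow_sub_sq_integrable_and_integral_eq {a : ℝ} (h1 : -(1 / 2) < a) (h2 : a < 1 / 2)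
    {t : ℝ} (ht : 0 ≤ t) :
    Integrable (fun u : ℝ => (posPow a u - posPow a (u - t)) ^ 2) ∧
      ∫ u : ℝ, (posPow a u - posPow a (u - t)) ^ 2 = t ^ (2 * a + 1) * posPowNormSq a := by
  have hpos : 2 * a + 1 ≠ 0 := by linarith
  rcases ht.eq_or_lt with rfl | ht
  · simp [Real.zero_rpow hpos]
  have hscale (x : ℝ) : posPow a x = t ^ a * posPow a (x / t) := by
    unfold posPow
    by_cases hx : 0 < x
    · rw [if_pos hx, if_pos (by positivity), ← Real.mul_rpow ht.le (by positivity)]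
      congr 1
      field_simp
    · rw [if_neg hx, if_neg, mul_zero]
      rw [not_lt] at hx ⊢
      exact div_nonpos_of_nonpos_of_nonneg hx ht.le
  have heq : (fun u : ℝ => (posPow a u - posPow a (u - t)) ^ 2) =
      fun u => t ^ (2 * a) * (posPow a (u / t) - posPow a (u / t - 1)) ^ 2 := by
    funext u
    rw [hscale u, hscale (u - t), sub_div, div_self ht.ne', rpow_two_mul ht]
    ring
  have hi := (posPow_sub_sq_integrable_and_normSq_eq h1 h2).1
  rw [heq]
  refine ⟨(hi.comp_div ht.ne').const_mul _, ?_⟩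
  rw [integral_const_mul,
    Measure.integral_comp_div (fun v => (posPow a v - posPow a (v - 1)) ^ 2) t,
    abs_of_pos ht, Real.rpow_add_one ht.ne', posPowNormSq, smul_eq_mul, mul_assoc]

/-- The kernel representing the `i`-th value of fractional Gaussian noise in `L²(ℝ)`. -/
noncomputable def fgnKernel (H : ℝ) (i : ℕ) (u : ℝ) : ℝ :=
  posPow (H - 1 / 2) (u - i) - posPow (H - 1 / 2) (u - i - 1)

theorem fgnKernel_mul_integrable_and_integral_eq {H : ℝ} (hH : H ∈ Ioo (0 : ℝ) 1) (i m : ℕ) :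
    Integrable (fun u => fgnKernel H i u * fgnKernel H (i + m) u) ∧
      ∫ u, fgnKernel H i u * fgnKernel H (i + m) u =
        posPowNormSq (H - 1 / 2) * fgnRho H m := by
  set a := H - 1 / 2 with ha
  have h1 : -(1 / 2) < a := by linarith [hH.1]
  have h2 : a < 1 / 2 := by linarith [hH.2]
  have h2H : 2 * a + 1 = 2 * H := by rw [ha]; ring
  have hD {t : ℝ} (ht : 0 ≤ t) (c : ℝ) :
      Integrable (fun u : ℝ => (posPow a (u - c) - posPow a (u - c - t)) ^ 2) ∧
      ∫ u : ℝ, (posPow a (u - c) - posPow a (u - c - t)) ^ 2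
        = t ^ (2 * H) * posPowNormSq a := by
    obtain ⟨hi, hv⟩ := posPow_sub_sq_integrable_and_integral_eq h1 h2 ht
    refine ⟨hi.comp_sub_right c, ?_⟩
    rw [integral_sub_right_eq_self (fun u => (posPow a u - posPow a (u - t)) ^ 2), hv, h2H]
  rcases Nat.eq_zero_or_pos m with rfl | hm
  · obtain ⟨hi, hv⟩ := hD zero_le_one (i : ℝ)
    simp only [add_zero, fgnKernel, ← ha, ← pow_two]
    refine ⟨hi, ?_⟩
    rw [hv]
    simp [fgnRho]
  · have hm1 : (1 : ℝ) ≤ m := by exact_mod_cast hm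
    obtain ⟨hi₁, hv₁⟩ := hD (by linarith : (0 : ℝ) ≤ m + 1) (i : ℝ)
    obtain ⟨hi₂, hv₂⟩ := hD (by linarith : (0 : ℝ) ≤ m - 1) ((i : ℝ) + 1)
    obtain ⟨hi₃, hv₃⟩ := hD (by linarith : (0 : ℝ) ≤ m) (i : ℝ)
    obtain ⟨hi₄, hv₄⟩ := hD (by linarith : (0 : ℝ) ≤ m) ((i : ℝ) + 1)
    have heq : (fun u => fgnKernel H i u * fgnKernel H (i + m) u) = fun u =>
        (((posPow a (u - i) - posPow a (u - i - (m + 1))) ^ 2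
          + (posPow a (u - (i + 1)) - posPow a (u - (i + 1) - (m - 1))) ^ 2)
          - ((posPow a (u - i) - posPow a (u - i - m)) ^ 2
          + (posPow a (u - (i + 1)) - posPow a (u - (i + 1) - m)) ^ 2)) * (1 / 2) := by
      funext u
      have e1 : u - ((i + m : ℕ) : ℝ) = u - i - m := by push_cast; ring
      have e2 : u - i - m - 1 = u - i - (m + 1) := by ring
      have e3 : u - (i + 1) - ((m : ℝ) - 1) = u - i - m := by ring
      have e4 : u - (i + 1) - (m : ℝ) = u - i - (m + 1) := by ring
      have e5 : u - i - 1 = u - ((i : ℝ) + 1) := by ring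
      simp only [fgnKernel, ← ha, e1, e2, e3, e4, e5]
      ring
    rw [heq]
    refine ⟨((hi₁.add hi₂).sub (hi₃.add hi₄)).mul_const _, ?_⟩
    rw [integral_mul_const, integral_sub (hi₁.fun_add hi₂) (hi₃.fun_add hi₄), integral_add hi₁ hi₂,
      integral_add hi₃ hi₄, hv₁, hv₂, hv₃, hv₄, fgnRho, if_neg hm.ne']
    ring

theorem fgnKernel_mul_integrable_and_integral_eq_dist {H : ℝ} (hH : H ∈ Ioo (0 : ℝ) 1)
    (i j : ℕ) :
    Integrable (fun u => fgnKernel H i u * fgnKernel H j u) ∧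
      ∫ u, fgnKernel H i u * fgnKernel H j u =
        posPowNormSq (H - 1 / 2) * fgnRho H (Nat.dist i j) := by
  rcases le_total i j with h | h
  · obtain ⟨m, rfl⟩ := Nat.exists_eq_add_of_le h
    simpa [Nat.dist_eq_sub_of_le h] using fgnKernel_mul_integrable_and_integral_eq hH i m
  · obtain ⟨m, rfl⟩ := Nat.exists_eq_add_of_le h
    simpa [Nat.dist_comm, Nat.dist_eq_sub_of_le h, mul_comm] using
      fgnKernel_mul_integrable_and_integral_eq hH j m

theorem posPowNormSq_pos {H : ℝ} (hH : H ∈ Ioo (0 : ℝ) 1) : 0 < posPowNormSq (H - 1 / 2) := by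
  have h1 : -(1 / 2) < H - 1 / 2 := by linarith [hH.1]
  have h2 : H - 1 / 2 < 1 / 2 := by linarith [hH.2]
  have h := (posPow_sub_sq_integrable_and_normSq_eq h1 h2).2
  have hb := ProbabilityTheory.beta_pos (α := H - 1 / 2 + 1) (β := 1 - 2 * (H - 1 / 2))
    (by linarith) (by linarith)
  have : 0 < (1 - (H - 1 / 2)) * ProbabilityTheory.beta (H - 1 / 2 + 1) (1 - 2 * (H - 1 / 2)) :=
    mul_pos (by linarith) hb
  rw [← h] at this
  exact pos_of_mul_pos_right this (by linarith)

theorem fgnSigmaSq_mul_posPowNormSq {H : ℝ} (hH : H ∈ Ioo (0 : ℝ) 1) :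
    fgnSigmaSq H * posPowNormSq (H - 1 / 2) = 1 / (2 * H) := by
  have h1 : -(1 / 2) < H - 1 / 2 := by linarith [hH.1]
  have h2 : H - 1 / 2 < 1 / 2 := by linarith [hH.2]
  have hH0 := hH.1
  have h := (posPow_sub_sq_integrable_and_normSq_eq h1 h2).2
  have e1 : 2 * (H - 1 / 2) + 1 = 2 * H := by ring
  have e2 : H - 1 / 2 + 1 = H + 1 / 2 := by ring
  have e3 : 1 - 2 * (H - 1 / 2) = 2 - 2 * H := by ring
  have e4 : H + 1 / 2 + (2 - 2 * H) = (3 / 2 - H) + 1 := by ring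
  have e5 : 1 - (H - 1 / 2) = 3 / 2 - H := by ring
  have h32 : 0 < 3 / 2 - H := by linarith [hH.2]
  rw [ProbabilityTheory.beta, e1, e2, e3, e4, e5, Real.Gamma_add_one h32.ne'] at h
  have g1 := Real.Gamma_pos_of_pos h32
  have g2 : 0 < Real.Gamma (H + 1 / 2) := Real.Gamma_pos_of_pos (by linarith)
  have g3 : 0 < Real.Gamma (2 - 2 * H) := Real.Gamma_pos_of_pos (by linarith [hH.2])
  have hV : posPowNormSq (H - 1 / 2) =
      Real.Gamma (H + 1 / 2) * Real.Gamma (2 - 2 * H) / Real.Gamma (3 / 2 - H) / (2 * H) := by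
    rw [eq_div_iff (by positivity), mul_comm, h]
    generalize 3 / 2 - H = c at *
    field_simp
  rw [hV, fgnSigmaSq]
  generalize Real.Gamma (3 / 2 - H) = c₁ at *
  generalize Real.Gamma (2 - 2 * H) = c₂ at *
  field_simp

theorem fgnSigmaSq_pos {H : ℝ} (hH : H ∈ Ioo (0 : ℝ) 1) : 0 < fgnSigmaSq H := by
  have h := fgnSigmaSq_mul_posPowNormSq hH
  have hH0 := hH.1
  have : 0 < fgnSigmaSq H * posPowNormSq (H - 1 / 2) := by rw [h]; positivity
  exact pos_of_mul_pos_left this (posPowNormSq_pos hH).le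

theorem fgnSigmaSq_mul_sq_le_dotProduct {H : ℝ} (hH : H ∈ Ioo (0 : ℝ) 1) {n : ℕ}
    (x : Fin (n + 1) → ℝ) :
    fgnSigmaSq H * x 0 ^ 2 ≤ x ⬝ᵥ (fgnCov H (n + 1) *ᵥ x) := by
  have hV := posPowNormSq_pos hH
  set a := H - 1 / 2 with ha
  have h1 : -(1 / 2) < a := by linarith [hH.1]
  have hsq (u : ℝ) : (∑ i, x i * fgnKernel H i.val u) ^ 2 =
      ∑ i, ∑ j, x i * x j * (fgnKernel H i.val u * fgnKernel H j.val u) := by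
    rw [pow_two, Finset.sum_mul_sum]
    exact Finset.sum_congr rfl fun i _ => Finset.sum_congr rfl fun j _ => by ring
  have hterm (i j : Fin (n + 1)) :
      Integrable (fun u => x i * x j * (fgnKernel H i.val u * fgnKernel H j.val u)) :=
    (fgnKernel_mul_integrable_and_integral_eq_dist hH i j).1.const_mul _
  have hInt : Integrable (fun u => (∑ i, x i * fgnKernel H i.val u) ^ 2) := by
    simp only [hsq]
    exact integrable_finsetSum _ fun i _ => integrable_finsetSum _ fun j _ => hterm i j
  have hval : ∫ u, (∑ i, x i * fgnKernel H i.val u) ^ 2 =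
      posPowNormSq a * (x ⬝ᵥ (fgnCov H (n + 1) *ᵥ x)) := by
    simp only [hsq]
    rw [integral_finsetSum _ fun i _ => integrable_finsetSum _ fun j _ => hterm i j]
    simp only [dotProduct, mulVec, Finset.mul_sum, fgnCov, Matrix.of_apply]
    refine Finset.sum_congr rfl fun i _ => ?_
    rw [integral_finsetSum _ fun j _ => hterm i j]
    refine Finset.sum_congr rfl fun j _ => ?_
    rw [integral_const_mul, (fgnKernel_mul_integrable_and_integral_eq_dist hH i j).2]
    ring
  have hunit : ∫ u in Ioc (0 : ℝ) 1, (∑ i, x i * fgnKernel H i.val u) ^ 2 =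
      x 0 ^ 2 * (1 / (2 * H)) := by
    have heq : EqOn (fun u => (∑ i, x i * fgnKernel H i.val u) ^ 2)
        (fun u => x 0 ^ 2 * (u ^ a) ^ 2) (Ioc 0 1) := by
      intro u hu
      have h0 : fgnKernel H 0 u = u ^ a := by
        simp [fgnKernel, posPow, hu.1, hu.2.not_gt, ha]
      have hs (i : Fin n) : fgnKernel H (i.val + 1) u = 0 := by
        have : (0 : ℝ) ≤ i.val := Nat.cast_nonneg _
        have e1 : ¬ (0 < u - ((i.val : ℝ) + 1)) := by linarith [hu.2]
        have e2 : ¬ (0 < u - ((i.val : ℝ) + 1) - 1) := by linarith [hu.2]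
        simp only [fgnKernel, posPow, Nat.cast_add, Nat.cast_one, if_neg e1, if_neg e2, sub_zero]
      simp only [Fin.sum_univ_succ, Fin.val_zero, h0, Fin.val_succ, hs, mul_zero,
        Finset.sum_const_zero, add_zero, mul_pow]
    rw [setIntegral_congr_fun measurableSet_Ioc heq, integral_const_mul,
      (rpow_sq_integrableOn_Ioc h1).2, ha]
    ring_nf
  have hle := setIntegral_le_integral (s := Ioc (0 : ℝ) 1) hInt
    (Eventually.of_forall fun u => sq_nonneg (∑ i, x i * fgnKernel H i.val u))
  rw [hunit, hval, ← fgnSigmaSq_mul_posPowNormSq hH] at hle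
  refine le_of_mul_le_mul_left ?_ hV
  linarith

theorem fgnCov_isHermitian (H : ℝ) (n : ℕ) : (fgnCov H n).IsHermitian :=
  Matrix.IsHermitian.ext fun i j => by simp [fgnCov, Nat.dist_comm]

theorem fgnCov_submatrix_succ (H : ℝ) (n : ℕ) :
    (fgnCov H (n + 1)).submatrix Fin.succ Fin.succ = fgnCov H n := by
  ext i j
  simp [fgnCov, Nat.dist_succ_succ]

theorem cons_zero_dotProduct_fgnCov (H : ℝ) {n : ℕ} (y : Fin n → ℝ) :
    (Fin.cons 0 y : Fin (n + 1) → ℝ) ⬝ᵥ (fgnCov H (n + 1) *ᵥ (Fin.cons 0 y : Fin (n + 1) → ℝ)) =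
      y ⬝ᵥ (fgnCov H n *ᵥ y) := by
  simp [dotProduct, mulVec, Fin.sum_univ_succ, fgnCov, Nat.dist_succ_succ]

theorem snoc_zero_dotProduct_fgnCov (H : ℝ) {n : ℕ} (y : Fin n → ℝ) :
    (Fin.snoc y 0 : Fin (n + 1) → ℝ) ⬝ᵥ
      (fgnCov H (n + 1) *ᵥ (Fin.snoc y 0 : Fin (n + 1) → ℝ)) = y ⬝ᵥ (fgnCov H n *ᵥ y) := by
  simp [dotProduct, mulVec, Fin.sum_univ_castSucc, fgnCov]

theorem fgnCov_posDef {H : ℝ} (hH : H ∈ Ioo (0 : ℝ) 1) (n : ℕ) : (fgnCov H n).PosDef := by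
  refine Matrix.PosDef.of_dotProduct_mulVec_pos (fgnCov_isHermitian H n) ?_
  induction n with
  | zero => exact fun x hx => absurd (Subsingleton.elim x 0) hx
  | succ n ih =>
    intro x hx
    rw [star_trivial]
    by_cases h0 : x 0 = 0
    · have hcons : x = Fin.cons 0 (Fin.tail x) := by rw [← h0, Fin.cons_self_tail]
      have htail : Fin.tail x ≠ 0 := by
        intro h
        apply hx
        rw [hcons, h]
        ext i
        refine Fin.cases ?_ (fun j => ?_) i <;> simp
      have := ih htail
      rw [star_trivial] at this
      rwa [hcons, cons_zero_dotProduct_fgnCov]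
    · have hσ := fgnSigmaSq_pos hH
      refine lt_of_lt_of_le ?_ (fgnSigmaSq_mul_sq_le_dotProduct hH x)
      positivity

/-- The minimizer of the quadratic form of a positive definite matrix on the affine hyperplane
`x 0 = 1`, together with the value of the minimum as a ratio of determinants. -/
theorem Matrix.PosDef.exists_mulVec_eq_single_det_div_det {n : ℕ}
    {M : Matrix (Fin (n + 1)) (Fin (n + 1)) ℝ} (hM : M.PosDef) :
    ∃ x : Fin (n + 1) → ℝ, x 0 = 1 ∧
      M *ᵥ x = Pi.single 0 (M.det / (M.submatrix Fin.succ Fin.succ).det) := by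
  have hd := hM.det_pos
  have hd' := (hM.submatrix (Fin.succ_injective n)).det_pos
  set v := M.det / (M.submatrix Fin.succ Fin.succ).det with hv
  refine ⟨M⁻¹ *ᵥ Pi.single 0 v, ?_, ?_⟩
  · have hadj : M.adjugate 0 0 = (M.submatrix Fin.succ Fin.succ).det := by
      rw [Matrix.adjugate_fin_succ_eq_det_submatrix]
      simp [Fin.succAbove_zero]
    simp only [Matrix.mulVec_single, Matrix.inv_def, Ring.inverse_eq_inv', Pi.smul_apply,
      Matrix.col_apply, Matrix.smul_apply, hadj, smul_eq_mul, hv]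
    simp
    field_simp
  · rw [Matrix.mulVec_mulVec, Matrix.mul_nonsing_inv _ (Ne.isUnit hd.ne'), Matrix.one_mulVec]

theorem Matrix.PosDef.det_div_det_le_dotProduct {n : ℕ}
    {M : Matrix (Fin (n + 1)) (Fin (n + 1)) ℝ} (hM : M.PosDef) {z : Fin (n + 1) → ℝ}
    (hz : z 0 = 1) :
    M.det / (M.submatrix Fin.succ Fin.succ).det ≤ z ⬝ᵥ (M *ᵥ z) := by
  obtain ⟨x, hx0, hx⟩ := hM.exists_mulVec_eq_single_det_div_det
  set v := M.det / (M.submatrix Fin.succ Fin.succ).det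
  have hd := hM.posSemidef.dotProduct_mulVec_nonneg (z - x)
  rw [star_trivial] at hd
  have hsymm : x ⬝ᵥ (M *ᵥ z) = z ⬝ᵥ (M *ᵥ x) := by
    have ht : Mᵀ = M := by simpa using hM.isHermitian.eq
    rw [Matrix.dotProduct_mulVec, ← Matrix.mulVec_transpose, ht, dotProduct_comm]
  rw [Matrix.mulVec_sub, sub_dotProduct, dotProduct_sub, dotProduct_sub, hsymm, hx] at hd
  simp only [dotProduct_single, hz, hx0] at hd
  linarith

/-- The one-step prediction error variance of fractional Gaussian noise given `n` past values. -/
noncomputable def fgnInnovation (H : ℝ) (n : ℕ) : ℝ :=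
  (fgnCov H (n + 1)).det / (fgnCov H n).det

theorem fgnInnovation_le_dotProduct {H : ℝ} (hH : H ∈ Ioo (0 : ℝ) 1) {n : ℕ}
    {z : Fin (n + 1) → ℝ} (hz : z 0 = 1) :
    fgnInnovation H n ≤ z ⬝ᵥ (fgnCov H (n + 1) *ᵥ z) := by
  have := (fgnCov_posDef hH (n + 1)).det_div_det_le_dotProduct hz
  rwa [fgnCov_submatrix_succ] at this

theorem exists_fgnInnovation_eq_dotProduct {H : ℝ} (hH : H ∈ Ioo (0 : ℝ) 1) (n : ℕ) :
    ∃ x : Fin (n + 1) → ℝ, x 0 = 1 ∧ x ⬝ᵥ (fgnCov H (n + 1) *ᵥ x) = fgnInnovation H n := by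
  obtain ⟨x, hx0, hx⟩ := (fgnCov_posDef hH (n + 1)).exists_mulVec_eq_single_det_div_det
  refine ⟨x, hx0, ?_⟩
  rw [hx, dotProduct_single, hx0, one_mul, fgnCov_submatrix_succ, fgnInnovation]

theorem fgnSigmaSq_le_fgnInnovation {H : ℝ} (hH : H ∈ Ioo (0 : ℝ) 1) (n : ℕ) :
    fgnSigmaSq H ≤ fgnInnovation H n := by
  obtain ⟨x, hx0, hx⟩ := exists_fgnInnovation_eq_dotProduct hH n
  simpa [hx0, hx] using fgnSigmaSq_mul_sq_le_dotProduct hH x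

theorem fgnInnovation_antitone {H : ℝ} (hH : H ∈ Ioo (0 : ℝ) 1) :
    Antitone (fgnInnovation H) := by
  refine antitone_nat_of_succ_le fun n => ?_
  obtain ⟨x, hx0, hx⟩ := exists_fgnInnovation_eq_dotProduct hH n
  rw [← hx, ← snoc_zero_dotProduct_fgnCov]
  refine fgnInnovation_le_dotProduct hH ?_
  rw [← Fin.castSucc_zero, Fin.snoc_castSucc, hx0]

theorem log_det_fgnCov_eq_sum {H : ℝ} (hH : H ∈ Ioo (0 : ℝ) 1) (n : ℕ) :
    Real.log (fgnCov H n).det = ∑ k ∈ Finset.range n, Real.log (fgnInnovation H k) := by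
  induction n with
  | zero => simp
  | succ n ih =>
    rw [Finset.sum_range_succ, ← ih, fgnInnovation, Real.log_div
      (fgnCov_posDef hH (n + 1)).det_pos.ne' (fgnCov_posDef hH n).det_pos.ne']
    ring

theorem exists_tendsto_log_det_fgnCov_div {H : ℝ} (hH : H ∈ Ioo (0 : ℝ) 1) :
    ∃ L : ℝ, Tendsto (fun n : ℕ => Real.log (fgnCov H n).det / (n : ℝ)) atTop (𝓝 L) ∧
      Real.log (fgnSigmaSq H) ≤ L := by
  have hσ := fgnSigmaSq_pos hH
  have hle (n : ℕ) : Real.log (fgnSigmaSq H) ≤ Real.log (fgnInnovation H n) :=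
    Real.log_le_log hσ (fgnSigmaSq_le_fgnInnovation hH n)
  have hanti : Antitone fun n => Real.log (fgnInnovation H n) := fun m n hmn =>
    Real.log_le_log (hσ.trans_le (fgnSigmaSq_le_fgnInnovation hH n))
      (fgnInnovation_antitone hH hmn)
  have hlim := tendsto_atTop_ciInf hanti ⟨_, forall_mem_range.2 hle⟩
  refine ⟨_, ?_, le_ciInf hle⟩
  refine hlim.cesaro.congr fun n => ?_
  rw [log_det_fgnCov_eq_sum hH, div_eq_inv_mul]

/-- The limit `L(H) = lim (1/n) log det Σ_n(H)` exists in `ℝ` and is at least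
`log σ²_H`; equivalently, the entropy rate exists, is finite, and equals
`(1 + log 2π)/2 + L/2 ≥ (1 + log 2π)/2 + log σ_H`. -/
theorem fgn_entropy_rate_exists_and_lower_bound (H : ℝ) (hH : H ∈ Set.Ioo (0 : ℝ) 1) :
    ∃ L : ℝ,
      Filter.Tendsto (fun n : ℕ => Real.log (fgnCov H n).det / (n : ℝ))
        Filter.atTop (nhds L) ∧
      Real.log (fgnSigmaSq H) ≤ L ∧
      Filter.Tendsto (fun n : ℕ =>
          (((n : ℝ) / 2) * (1 + Real.log (2 * π))
            + (1 / 2) * Real.log (fgnCov H n).det) / (n : ℝ))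
        Filter.atTop (nhds ((1 + Real.log (2 * π)) / 2 + L / 2)) := by
  obtain ⟨L, hL, hσ⟩ := exists_tendsto_log_det_fgnCov_div hH
  refine ⟨L, hL, hσ, ?_⟩
  refine (tendsto_const_nhds.add (hL.div_const 2)).congr' ?_
  filter_upwards [eventually_gt_atTop 0] with n hn
  have hn0 : (n : ℝ) ≠ 0 := by exact_mod_cast hn.ne'
  field_simp
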